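/- Under stable writes, with b - b_{N+1} = (N/(N+1))λv, K = μSN/(rv), t^{N+1} = rvK/((N+1)b_{N+1}), and the storage constraint (N+1)(1-μ)S/(Nλv) > t^{N+1}, the write rate satisfies λ < (1 + 1/N - μ)·(b/v). -/

import Mathlib

theorem storage_bound_stable_writes (N : ℕ) (hN : 1 ≤ N)
    (b v lam S μ K r bN1 tN1 : ℝ)
    (hb : 0 < b) (hv : 0 < v) (hlam : 0 < lam) (hS : 0 < S)
    (hμ0 : 0 < μ) (hμ1 : μ < 1) (hK : 0 < K) (hr : 0 < r) (hbN1 : 0 < bN1)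
    (hbN1b : bN1 < b)
    (hband : b - bN1 = (N / (N + 1)) * lam * v)
    (hKeq : K = μ * S * N / (r * v))
    (ht : tN1 = r * v * K / ((N + 1) * bN1))
    (hstorage : (N + 1) * (1 - μ) * S / (N * lam * v) > tN1) :
    lam < (1 + 1 / N - μ) * (b / v) := by
  have hn : (0 : ℝ) < N := by exact_mod_cast hN
  set n : ℝ := (N : ℝ)
  have hx : 0 < lam * v := mul_pos hlam hv
  have hrvK : r * v * K = μ * S * n := by
    rw [hKeq]
    field_simp
  rw [ht, hrvK, gt_iff_lt, div_lt_div_iff₀ (by positivity) (by positivity)] at hstorage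
  have hdelay : μ * n ^ 2 * (lam * v) < (n + 1) ^ 2 * (1 - μ) * bN1 := by
    refine lt_of_mul_lt_mul_left ?_ hS.le
    linarith
  have hband' : (n + 1) * bN1 = (n + 1) * b - n * (lam * v) := by
    field_simp at hband
    linarith
  have hden : 0 < n + 1 - μ := by linarith
  have hrate : n * (lam * v) * (n + 1 - μ) < (n + 1) ^ 2 * (1 - μ) * b := by
    linear_combination hdelay + (n + 1) * (1 - μ) * hband'
  have hmain : n * (lam * v) < (n + 1 - n * μ) * b := by
    refine lt_of_mul_lt_mul_right ?_ hden.le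
    have hgap : 0 < n * μ ^ 2 * b := by positivity
    linarith
  have hrhs : (1 + 1 / n - μ) * (b / v) = (n + 1 - n * μ) * b / (n * v) := by
    field_simp
  rw [hrhs, lt_div_iff₀ (by positivity)]
  linarith
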